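/- arXiv:1008.3529 — 2 statements merged into one kernel-verified Lean document; each statement's English description precedes it below -/
import Mathlib

section
/- Let p be a nonzero integer and let m = |p|. Let Q be the (m+4) × (m+4) symmetric matrix over ℚ whose upper-left m × m block is sgn(p) times the identity, whose lower-right 4 × 4 block is the matrix [[1−p, 0, 0, 1], [0, 1, 0, 1], [0, 0, 1, 1], [1, 1, 1, 2]], and whose off-diagonal blocks are zero. Let v be the vector in ℚ^{m+4} whose first m entries are 1 and whose last four entries are (1−p, 1, 1, 0). Then vᵀ · Q⁻¹ · v = 9p − 6. -/
open Matrix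

/-- The plumbing block of the intersection matrix. -/
def plumbingBlock (p : ℚ) : Matrix (Fin 4) (Fin 4) ℚ :=
  !![1 - p, 0, 0, 1; 0, 1, 0, 1; 0, 0, 1, 1; 1, 1, 1, 2]

lemma det_plumbingBlock (p : ℚ) : (plumbingBlock p).det = -1 := by
  simp [plumbingBlock, det_succ_row_zero, Fin.sum_univ_succ, Fin.succAbove]
  ring

lemma plumbingBlock_mulVec (p : ℚ) :
    plumbingBlock p *ᵥ ![-2, 3 * p - 2, 3 * p - 2, 3 - 3 * p] = ![1 - p, 1, 1, 0] := by
  ext i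
  fin_cases i <;> simp [plumbingBlock, mulVec, dotProduct, Fin.sum_univ_succ] <;> ring

lemma dotProduct_inv_mulVec_of_mulVec_eq {n R : Type*} [Fintype n] [DecidableEq n] [CommRing R]
    {A : Matrix n n R} (hA : IsUnit A.det) {v w : n → R} (h : A *ᵥ w = v) :
    v ⬝ᵥ A⁻¹ *ᵥ v = v ⬝ᵥ w := by
  rw [← h, mulVec_mulVec, nonsing_inv_mul A hA, one_mulVec]

/-- for `p ≠ 0`, `m = |p|`, `Q` the `(m+4) × (m+4)` intersection matrix (block
diagonal with blocks `sgn(p)·I_m` and `[[1−p,0,0,1],[0,1,0,1],[0,0,1,1],[1,1,1,2]]`) and `v`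
the vector whose first `m` entries are `1` and last four entries are `(1−p, 1, 1, 0)`, one has
`vᵀ · Q⁻¹ · v = 9p − 6`. -/
theorem stmt_10 (p : ℤ) (hp : p ≠ 0) (m : ℕ) (hm : m = p.natAbs)
    (Q : Matrix (Fin (m + 4)) (Fin (m + 4)) ℚ)
    (hQ : Q = Matrix.reindex finSumFinEquiv finSumFinEquiv
      (Matrix.fromBlocks ((p.sign : ℚ) • (1 : Matrix (Fin m) (Fin m) ℚ)) 0 0
        !![1 - (p : ℚ), 0, 0, 1; 0, 1, 0, 1; 0, 0, 1, 1; 1, 1, 1, 2]))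
    (v : Fin (m + 4) → ℚ)
    (hv : v = Sum.elim (fun _ : Fin m => (1 : ℚ)) ![1 - (p : ℚ), 1, 1, 0] ∘
      finSumFinEquiv.symm) :
    v ⬝ᵥ Q⁻¹.mulVec v = 9 * (p : ℚ) - 6 := by
  have hs : (p.sign : ℚ) * p.sign = 1 := by
    rcases hp.lt_or_gt with h | h
    · simp [Int.sign_eq_neg_one_of_neg h]
    · simp [Int.sign_eq_one_of_pos h]
  have hsm : (m : ℚ) * p.sign = p := by
    rw [hm, mul_comm, ← Int.cast_natCast, ← Int.cast_mul, Int.sign_mul_natAbs]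
  change Q = reindex _ _ (fromBlocks _ 0 0 (plumbingBlock p)) at hQ
  have hdet : IsUnit Q.det := by
    rw [hQ, det_reindex_self, det_fromBlocks_zero₂₁, det_plumbingBlock, det_smul, det_one]
    exact ((IsUnit.of_mul_eq_one _ hs).pow _ |>.mul isUnit_one).mul isUnit_one.neg
  have hmul : Q *ᵥ (Sum.elim (fun _ : Fin m => (p.sign : ℚ))
      ![-2, 3 * (p : ℚ) - 2, 3 * p - 2, 3 - 3 * p] ∘ finSumFinEquiv.symm) = v := by
    rw [hQ, hv, reindex_apply, submatrix_mulVec_equiv, Function.comp_assoc, Equiv.symm_symm,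
      Equiv.symm_comp_self, Function.comp_id, fromBlocks_mulVec]
    congr 1
    simp only [Sum.elim_comp_inl, Sum.elim_comp_inr, plumbingBlock_mulVec, zero_mulVec, zero_add,
      add_zero, smul_mulVec, one_mulVec]
    congr 1
    ext
    simpa using hs
  rw [dotProduct_inv_mulVec_of_mulVec_eq hdet hmul, hv, comp_equiv_dotProduct_comp_equiv,
    sumElim_dotProduct_sumElim]
  simp [dotProduct, Fin.sum_univ_succ]
  linear_combination hsm
end

section
/- Let p be a nonzero integer and let m = |p|. Let Q be the (m+4) × (m+4) symmetric matrix over ℝ whose upper-left m × m block is sgn(p) times the identity, whose lower-right 4 × 4 block is [[1−p, 0, 0, 1], [0, 1, 0, 1], [0, 0, 1, 1], [1, 1, 1, 2]], and whose off-diagonal blocks are zero. Then there exists an invertible real (m+4) × (m+4) matrix P such that Pᵀ · Q · P is a diagonal matrix with exactly (m + p + 6)/2 diagonal entries equal to 1 and exactly (m − p + 2)/2 diagonal entries equal to −1; in particular the signature of Q is ((m+p+6)/2) − ((m−p+2)/2) = p + 2. -/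
open Matrix Finset

/-- Counting the entries of a vector on `Fin (m + n)` glued from a constant and a second vector. -/
lemma card_filter_sumElim_const {m n : ℕ} (a c : ℝ) (b : Fin n → ℝ) :
    (univ.filter fun i : Fin (m + n) =>
      Sum.elim (fun _ : Fin m => a) b (finSumFinEquiv.symm i) = c).card =
      (if a = c then m else 0) + (univ.filter fun j => b j = c).card := by
  rw [card_filter, finSumFinEquiv.symm.sum_comp
    (fun x => if Sum.elim (fun _ : Fin m => a) b x = c then 1 else 0),
    Fintype.sum_sum_type, card_filter]
  refine congrArg₂ (· + ·) ?_ rfl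
  by_cases h : a = c <;> simp [h]

/-- The change of basis that diagonalizes the `4 × 4` block, with `t = p / 2`. -/
def blockBasis (t : ℝ) : Matrix (Fin 4) (Fin 4) ℝ :=
  !![1, 0, 0, 1; -t, 1, 0, 1 - t; -t, 0, 1, 1 - t; t, 0, 0, t - 1]

lemma blockBasis_congr (p : ℝ) :
    (blockBasis (p / 2))ᵀ * !![1 - p, 0, 0, 1; 0, 1, 0, 1; 0, 0, 1, 1; 1, 1, 1, 2] *
      blockBasis (p / 2) = diagonal ![1, 1, 1, -1] := by
  ext i j
  fin_cases i <;> fin_cases j <;>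
    simp [blockBasis, Matrix.mul_apply, Fin.sum_univ_four] <;> ring

lemma isUnit_blockBasis (t : ℝ) : IsUnit (blockBasis t) := by
  refine IsUnit.of_mul_eq_one
    !![1 - t, 0, 0, 1; 0, 1, 0, 1; 0, 0, 1, 1; t, 0, 0, -1] ?_
  ext i j
  fin_cases i <;> fin_cases j <;>
    simp [blockBasis, Matrix.mul_apply, Fin.sum_univ_four] <;> ring

/-- for `p ≠ 0` and `m = |p|`, the real `(m+4) × (m+4)` intersection matrix `Q`
(block diagonal with blocks `sgn(p)·I_m` and `[[1−p,0,0,1],[0,1,0,1],[0,0,1,1],[1,1,1,2]]`)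
can be diagonalized by an invertible matrix `P` via `Pᵀ · Q · P`, with exactly `(m+p+6)/2`
diagonal entries equal to `1` and exactly `(m−p+2)/2` diagonal entries equal to `−1`;
in particular the signature of `Q` is `(m+p+6)/2 − (m−p+2)/2 = p + 2`. -/
theorem stmt_11 (p : ℤ) (hp : p ≠ 0) (m : ℕ) (hm : m = p.natAbs)
    (Q : Matrix (Fin (m + 4)) (Fin (m + 4)) ℝ)
    (hQ : Q = Matrix.reindex finSumFinEquiv finSumFinEquiv
      (Matrix.fromBlocks ((p.sign : ℝ) • (1 : Matrix (Fin m) (Fin m) ℝ)) 0 0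
        !![1 - (p : ℝ), 0, 0, 1; 0, 1, 0, 1; 0, 0, 1, 1; 1, 1, 1, 2])) :
    ∃ P : Matrix (Fin (m + 4)) (Fin (m + 4)) ℝ, IsUnit P ∧
      ∃ d : Fin (m + 4) → ℝ, Pᵀ * Q * P = Matrix.diagonal d ∧
        ((univ.filter fun i => d i = 1).card : ℤ) = ((m : ℤ) + p + 6) / 2 ∧
        ((univ.filter fun i => d i = -1).card : ℤ) = ((m : ℤ) - p + 2) / 2 ∧
        (((m : ℤ) + p + 6) / 2) - (((m : ℤ) - p + 2) / 2) = p + 2 := by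
  subst hQ
  refine ⟨reindex finSumFinEquiv finSumFinEquiv (fromBlocks 1 0 0 (blockBasis (p / 2))), ?_,
    fun i => Sum.elim (fun _ => (p.sign : ℝ)) ![1, 1, 1, -1] (finSumFinEquiv.symm i), ?_, ?_⟩
  · rw [isUnit_iff_isUnit_det, det_reindex_self, det_fromBlocks_zero₂₁, det_one, one_mul,
      ← isUnit_iff_isUnit_det]
    exact isUnit_blockBasis _
  · simp only [reindex_apply, transpose_submatrix, submatrix_mul_equiv, fromBlocks_transpose,
      fromBlocks_multiply, transpose_zero, transpose_one, Matrix.mul_zero, Matrix.zero_mul,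
      Matrix.one_mul, Matrix.mul_one, add_zero, zero_add, blockBasis_congr]
    rw [smul_one_eq_diagonal, fromBlocks_diagonal, submatrix_diagonal_equiv]
    rfl
  · have h₁ : (univ.filter fun j => (![1, 1, 1, -1] : Fin 4 → ℝ) j = 1).card = 3 := by
      simp only [card_filter, Fin.sum_univ_four, Matrix.cons_val]
      norm_num
    have h₂ : (univ.filter fun j => (![1, 1, 1, -1] : Fin 4 → ℝ) j = -1).card = 1 := by
      simp only [card_filter, Fin.sum_univ_four, Matrix.cons_val]
      norm_num
    rw [card_filter_sumElim_const, card_filter_sumElim_const, h₁, h₂]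
    rcases hp.lt_or_gt with h | h
    · rw [Int.sign_eq_neg_one_of_neg h]
      norm_num
      omega
    · rw [Int.sign_eq_one_of_pos h]
      norm_num
      omega
end
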